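/- For every universal probability m, there exists a constant c ∈ ℕ such that |K(s) + log₂ m(s)| ≤ c for all s ∈ {0,1}*, i.e., K(s) = -log₂ m(s) + O(1). -/

import Mathlib

open Filter Topology

namespace Paper

/-- Finite binary strings. -/
abbrev Str := List Bool

/-- A computer: a partial recursive function on binary strings with prefix-free domain. -/
structure Computer where
  f : Str →. Str
  partrec : Partrec f
  prefixFree : ∀ p q : Str, (f p).Dom → (f q).Dom → p <+: q → p = q

/-- An optimal computer (universal self-delimiting Turing machine). -/
structure OptimalComputer extends Computer where
  optimal : ∀ C : Computer, ∃ sim : ℕ, ∀ p s, s ∈ C.f p →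
    ∃ p', s ∈ toComputer.f p' ∧ p'.length ≤ p.length + sim

/-- Prefix-free Kolmogorov complexity (program-size complexity) w.r.t. `U`. -/
noncomputable def Kc (U : OptimalComputer) (s : Str) : ℕ :=
  sInf {n | ∃ p : Str, p.length = n ∧ s ∈ U.f p}

/-- A semi-measure on binary strings: values in [0,1] with all finite partial sums ≤ 1. -/
def SemiMeasure (r : Str → ℝ) : Prop :=
  (∀ s, 0 ≤ r s ∧ r s ≤ 1) ∧ ∀ F : Finset Str, ∑ s ∈ F, r s ≤ 1

/-- Lower-computability: approximability from below by a total recursive rational function. -/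
def LowerComputable (r : Str → ℝ) : Prop :=
  ∃ f : ℕ → Str → ℚ, Computable₂ f ∧
    ∀ s : Str, (∀ n : ℕ, 0 ≤ f n s ∧ (f n s : ℝ) ≤ r s) ∧
      Tendsto (fun n => (f n s : ℝ)) atTop (nhds (r s))

/-- A lower-computable semi-measure. -/
def LCSemiMeasure (r : Str → ℝ) : Prop := SemiMeasure r ∧ LowerComputable r

/-- A universal probability: a lower-computable semi-measure dominating all
lower-computable semi-measures up to a positive multiplicative constant. -/
def UniversalProb (m : Str → ℝ) : Prop :=
  LCSemiMeasure m ∧ ∀ r : Str → ℝ, LCSemiMeasure r → ∃ c : ℝ, 0 < c ∧ ∀ s, c * r s ≤ m s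

/-- The first `n` bits of the base-two expansion of `T mod 1`
(the expansion with infinitely many zeros). -/
noncomputable def binPrefix (T : ℝ) (n : ℕ) : Str :=
  (List.range n).map (fun i => decide (⌊Int.fract T * 2 ^ (i + 1)⌋ % 2 = 1))

/-- A real is right-computable if it is the limit from above of a recursive
sequence of rationals. -/
def RightComputableReal (T : ℝ) : Prop :=
  ∃ g : ℕ → ℚ, Computable g ∧ (∀ n, T ≤ (g n : ℝ)) ∧
    Tendsto (fun n => (g n : ℝ)) atTop (nhds T)

/-- A real is left-computable if its negation is right-computable. -/
def LeftComputableReal (T : ℝ) : Prop := RightComputableReal (-T)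

/-- A computable real number. -/
def ComputableReal (T : ℝ) : Prop :=
  ∃ f : ℕ → ℚ, Computable f ∧ ∀ n : ℕ, |T - (f n : ℝ)| < (2 : ℝ)⁻¹ ^ n

/-- A recursively enumerable set of binary strings. -/
def REset (A : Set Str) : Prop :=
  ∃ g : Str →. Unit, Partrec g ∧ ∀ s, (g s).Dom ↔ s ∈ A

/-- `T` is weakly Chaitin `D`-random. -/
noncomputable def WeaklyChaitinDRandom (U : OptimalComputer) (D T : ℝ) : Prop :=
  ∃ c : ℕ, ∀ n : ℕ, D * n - c ≤ Kc U (binPrefix T n)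

/-- `T` is `D`-compressible. -/
noncomputable def DCompressible (U : OptimalComputer) (D T : ℝ) : Prop :=
  Filter.atTop.limsup (fun n : ℕ => (Kc U (binPrefix T n) : ℝ) / n) ≤ D


/-- The natural encoding of rationals as pairs (numerator, denominator). -/
def E0 (x : ℚ) : ℕ := @Encodable.encode ℚ Rat.instEncodable x

theorem E0_eq (x : ℚ) : E0 x = Nat.pair (Encodable.encode x.num) x.den := by
  cases x; rfl

theorem int_encode_ofNat (n : ℕ) : Encodable.encode (n : ℤ) = 2 * n := by
  show Equiv.intEquivNat (n : ℤ) = _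
  rfl

theorem int_encode_negSucc (n : ℕ) : Encodable.encode (Int.negSucc n) = 2 * n + 1 := by
  show Equiv.intEquivNat _ = _
  rfl

theorem int_natAbs_encode (a : ℤ) : a.natAbs = (Encodable.encode a + 1) / 2 := by
  cases a with
  | ofNat n =>
    have := int_encode_ofNat n
    simp only [Int.ofNat_eq_natCast] at *
    rw [this]; simp; omega
  | negSucc n => rw [int_encode_negSucc]; simp; omega

theorem int_encode_surj (k : ℕ) : ∃ a : ℤ, Encodable.encode a = k := by
  rcases Nat.even_or_odd' k with ⟨n, h | h⟩
  · exact ⟨n, by rw [int_encode_ofNat, h]⟩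
  · exact ⟨Int.negSucc n, by rw [int_encode_negSucc, h]⟩

theorem mem_range_E0 (c : ℕ) : c ∈ Set.range E0 ↔
    0 < c.unpair.2 ∧ Nat.Coprime ((c.unpair.1 + 1) / 2) c.unpair.2 := by
  constructor
  · rintro ⟨x, rfl⟩
    rw [E0_eq]
    simp only [Nat.unpair_pair]
    rw [← int_natAbs_encode]
    exact ⟨x.den_pos, x.reduced⟩
  · rintro ⟨h1, h2⟩
    obtain ⟨a, ha⟩ := int_encode_surj c.unpair.1
    rw [← ha, ← int_natAbs_encode] at h2
    refine ⟨⟨a, c.unpair.2, h1.ne', h2⟩, ?_⟩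
    rw [E0_eq]
    simp only [ha, Nat.pair_unpair]

theorem coprime_iff_bdd (a b : ℕ) (hb : 0 < b) :
    Nat.Coprime a b ↔ ∀ d < b + 1, ¬ (a % d = 0 ∧ b % d = 0 ∧ d ≠ 1) := by
  constructor
  · rintro h d - ⟨h1, h2, h3⟩
    exact h3 (Nat.eq_one_of_dvd_coprimes h (Nat.dvd_of_mod_eq_zero h1) (Nat.dvd_of_mod_eq_zero h2))
  · intro h
    by_contra hc
    refine h (Nat.gcd a b) (Nat.lt_succ_of_le (Nat.gcd_le_right _ hb)) ⟨?_, ?_, hc⟩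
    · exact Nat.mod_eq_zero_of_dvd (Nat.gcd_dvd_left a b)
    · exact Nat.mod_eq_zero_of_dvd (Nat.gcd_dvd_right a b)

theorem primrec_range_E0 : PrimrecPred (fun c => c ∈ Set.range E0) := by
  have hrel : PrimrecRel (fun (d : ℕ) (c : ℕ) =>
      ¬ (((c.unpair.1 + 1) / 2) % d = 0 ∧ c.unpair.2 % d = 0 ∧ d ≠ 1)) := by
    have hu1 : Primrec (fun p : ℕ × ℕ => p.2.unpair.1) :=
      Primrec.fst.comp (Primrec.unpair.comp Primrec.snd)
    have hu2 : Primrec (fun p : ℕ × ℕ => p.2.unpair.2) :=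
      Primrec.snd.comp (Primrec.unpair.comp Primrec.snd)
    have h1 : PrimrecPred (fun p : ℕ × ℕ => ((p.2.unpair.1 + 1) / 2) % p.1 = 0) :=
      Primrec.eq.comp (Primrec.nat_mod.comp
        (Primrec.nat_div.comp (Primrec.succ.comp hu1) (Primrec.const 2)) Primrec.fst)
        (Primrec.const 0)
    have h2 : PrimrecPred (fun p : ℕ × ℕ => p.2.unpair.2 % p.1 = 0) :=
      Primrec.eq.comp (Primrec.nat_mod.comp hu2 Primrec.fst) (Primrec.const 0)
    have h3 : PrimrecPred (fun p : ℕ × ℕ => p.1 ≠ 1) :=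
      (Primrec.eq.comp Primrec.fst (Primrec.const 1)).not
    exact (h1.and (h2.and h3)).not
  have hu2 : Primrec (fun p : ℕ => p.unpair.2) := Primrec.snd.comp Primrec.unpair
  have h := (Primrec.nat_lt.comp (Primrec.const 0) hu2).and
    (hrel.forall_lt.comp (Primrec.succ.comp hu2) Primrec.id)
  refine h.of_eq fun c => ?_
  rw [mem_range_E0]
  refine and_congr_right fun hb => ?_
  rw [coprime_iff_bdd _ _ hb]
  rfl

theorem E0_inj : Function.Injective E0 := @Encodable.encode_injective ℚ Rat.instEncodable

instance : Infinite (Set.range E0) :=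
  Infinite.of_injective _ (Equiv.ofInjective _ E0_inj).injective

theorem exists_next (x : ℕ) : ∃ m, x + m + 1 ∈ Set.range E0 := by
  have h : (Set.range E0).Infinite := Set.infinite_coe_iff.1 inferInstance
  obtain ⟨y, hy, hxy⟩ := h.exists_gt x
  exact ⟨y - x - 1, by rwa [show x + (y - x - 1) + 1 = y by omega]⟩

open Classical in
noncomputable def nextE (x : ℕ) : ℕ := x + Nat.find (exists_next x) + 1

theorem computable_nextE : Computable nextE := by
  classical
  have hp := (primrec_range_E0.comp (Primrec.succ.comp
    (Primrec.nat_add.comp Primrec.fst Primrec.snd) : Primrec fun p : ℕ × ℕ => (p.1 + p.2) + 1)).decide.to_comp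
  have hr : Partrec fun x : ℕ => Nat.rfind fun m => (decide (x + m + 1 ∈ Set.range E0) : Part Bool) :=
    Partrec.rfind (p := fun x m => (decide (x + m + 1 ∈ Set.range E0) : Part Bool)) hp.partrec
  have hm : Computable fun x : ℕ => Nat.find (exists_next x) := by
    refine hr.of_eq_tot fun x => ?_
    refine Nat.mem_rfind.2 ⟨?_, fun {m} hm => ?_⟩
    · simpa using! (Nat.find_spec (exists_next x))
    · simpa using! (Nat.find_min (exists_next x) hm)
  refine ((Primrec.succ.to_comp).comp (Primrec.nat_add.to_comp.comp Computable.id hm)).of_eq fun x => ?_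
  rfl

theorem E0_ofNat_succ (n : ℕ) :
    E0 (Denumerable.ofNat ℚ (n + 1)) = nextE (E0 (Denumerable.ofNat ℚ n)) := by
  let _ := @Encodable.decidableRangeEncode ℚ Rat.instEncodable
  have hinf : Infinite (Set.range (@Encodable.encode ℚ Rat.instEncodable)) :=
    inferInstanceAs (Infinite (Set.range E0))
  have key : ∀ n, E0 (Denumerable.ofNat ℚ n) =
      (Nat.Subtype.ofNat (Set.range (@Encodable.encode ℚ Rat.instEncodable)) n : ℕ) := by
    intro n
    have h1 : Denumerable.ofNat ℚ n = (@Encodable.equivRangeEncode ℚ Rat.instEncodable).symm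
        (Nat.Subtype.ofNat (Set.range (@Encodable.encode ℚ Rat.instEncodable)) n) := by
      let _ := Nat.Subtype.denumerable (Set.range (@Encodable.encode ℚ Rat.instEncodable))
      refine (Denumerable.ofEquiv_ofNat _ _ _).trans ?_
      refine congrArg _ ?_
      exact (Denumerable.ofEquiv_ofNat _ _ _).trans rfl
    rw [h1]
    exact congrArg Subtype.val ((@Encodable.equivRangeEncode ℚ Rat.instEncodable).apply_symm_apply _)
  rw [key, key, Nat.Subtype.ofNat, Nat.Subtype.succ, nextE]
  simp only
  congr!

theorem computable_E0 : Computable E0 := by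
  have h : Computable (fun n : ℕ => (Nat.rec (E0 (Denumerable.ofNat ℚ 0)) (fun _ x => nextE x) n : ℕ)) :=
    Computable.nat_rec (h := fun (_ : ℕ) (p : ℕ × ℕ) => nextE p.2)
      Computable.id (Computable.const _) (computable_nextE.comp (Computable.snd.comp Computable.snd))
  refine (h.comp Computable.encode).of_eq fun x => ?_
  have : ∀ n : ℕ, (Nat.rec (E0 (Denumerable.ofNat ℚ 0)) (fun _ x => nextE x) n : ℕ) = E0 (Denumerable.ofNat ℚ n) := by
    intro n
    induction n with
    | zero => rfl
    | succ n ih => rw [E0_ofNat_succ, ← ih]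
  rw [this, Denumerable.ofNat_encode]

/-- Numerator and denominator of a nonnegative rational, read off the code. -/
theorem rat_eq_of_nonneg (x : ℚ) (hx : 0 ≤ x) :
    (x : ℝ) = ((E0 x).unpair.1 / 2 : ℕ) / ((E0 x).unpair.2 : ℕ) ∧ 0 < (E0 x).unpair.2 := by
  rw [E0_eq]
  simp only [Nat.unpair_pair]
  refine ⟨?_, x.den_pos⟩
  obtain ⟨n, hn⟩ := Int.eq_ofNat_of_zero_le (Rat.num_nonneg.2 hx)
  have : (x : ℝ) = (x.num : ℝ) / (x.den : ℝ) := Rat.cast_def x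
  rw [this, hn, int_encode_ofNat]
  congr 2
  norm_num

/-- `Q 0 = 0`, `Q (l+1) = 2^{-l}`. -/
def Q (l : ℕ) : ℚ := Nat.casesOn l 0 (fun l => (2⁻¹ : ℚ) ^ l)

theorem E0_Q (l : ℕ) : E0 (Q l) = Nat.casesOn l (Nat.pair 0 1) (fun l => Nat.pair 2 (2 ^ l)) := by
  cases l with
  | zero => rfl
  | succ l =>
    have h : Q (l+1) = ⟨1, 2 ^ l, by positivity, by simp⟩ := by
      show (2⁻¹ : ℚ) ^ l = _
      rw [Rat.mk_eq_divInt, Rat.divInt_eq_div]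
      push_cast
      rw [inv_pow]; simp
    rw [h, E0_eq]
    rfl

theorem primrec_two_pow : Primrec (fun n : ℕ => 2 ^ n) := by
  have := (Primrec₂.unpaired'.1 Nat.Primrec.pow).comp (Primrec.const 2) Primrec.id
  exact this

theorem computable_Q : Computable Q := by
  have hE : Computable (fun l : ℕ => (Nat.casesOn l (Nat.pair 0 1) (fun l => Nat.pair 2 (2 ^ l)) : ℕ)) :=
    Computable.nat_casesOn (h := fun (_ : ℕ) l => Nat.pair 2 (2 ^ l)) Computable.id (Computable.const _)
      (Primrec₂.natPair.comp (Primrec.const 2) (primrec_two_pow.comp Primrec.snd)).to_comp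
  have hb : Computable₂ (fun l n : ℕ => decide (E0 (Denumerable.ofNat ℚ n) = E0 (Q l))) := by
    have h1 := Primrec.eq (α := ℕ).decide.to_comp
    refine (h1.comp ((computable_E0.comp (Computable.ofNat ℚ)).comp Computable.snd)
      (hE.comp Computable.fst)).of_eq fun p => ?_
    rw [← E0_Q]
  have hr := Partrec.rfind hb.partrec₂
  refine Computable.encode_iff.1 (hr.of_eq_tot fun l => ?_)
  refine Nat.mem_rfind.2 ⟨?_, fun {m} hm => ?_⟩
  · simp only [Part.mem_some_iff, PFun.coe_val, Denumerable.ofNat_encode]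
    simp
  · simp only [Part.mem_some_iff, PFun.coe_val]
    symm
    rw [decide_eq_false_iff_not]
    intro h
    have := E0_inj h
    rw [← this, Denumerable.encode_ofNat] at hm
    exact lt_irrefl _ hm

/-- Big-endian value of a binary string. -/
def val (p : Str) : ℕ := p.foldl (fun acc b => 2 * acc + b.toNat) 0

theorem val_foldl (p : Str) (a : ℕ) :
    p.foldl (fun acc b => 2 * acc + b.toNat) a = a * 2 ^ p.length + val p := by
  induction p generalizing a with
  | nil => simp [val]
  | cons b p ih =>
    simp only [val, List.foldl_cons, List.length_cons]
    rw [ih, ih (2 * 0 + b.toNat)]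
    ring

theorem val_append (p q : Str) : val (p ++ q) = val p * 2 ^ q.length + val q := by
  rw [val, List.foldl_append, val_foldl]
  rfl

theorem val_lt (p : Str) : val p < 2 ^ p.length := by
  induction p using List.reverseRecOn with
  | nil => simp [val]
  | append_singleton p b ih =>
    rw [val_append]
    have : val [b] ≤ 1 := by cases b <;> simp [val]
    simp only [List.length_append, List.length_singleton, pow_succ]
    omega

theorem val_surj (L t : ℕ) (h : t < 2 ^ L) : ∃ p : Str, p.length = L ∧ val p = t := by
  induction L generalizing t with
  | zero => exact ⟨[], rfl, by simp [val] at *; omega⟩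
  | succ L ih =>
    obtain ⟨p, hp, hv⟩ := ih (t / 2) (by rw [pow_succ] at h; omega)
    refine ⟨p ++ [decide (t % 2 = 1)], by simp [hp], ?_⟩
    rw [val_append, hv]
    rcases Nat.mod_two_eq_zero_or_one t with h0 | h0 <;> simp [val, h0] <;> omega

theorem primrec_val : Primrec val := by
  have : Primrec fun p : Str => p.foldl (fun acc b => 2 * acc + b.toNat) 0 := by
    refine Primrec.list_foldl (h := fun (_ : Str) (x : ℕ × Bool) => 2 * x.1 + x.2.toNat)
      Primrec.id (Primrec.const 0) ?_
    refine Primrec.nat_add.comp (Primrec.nat_double.comp (Primrec.fst.comp Primrec.snd)) ?_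
    exact (Primrec.dom_bool _).comp (Primrec.snd.comp Primrec.snd)
  exact this

/-- Lower and upper end of the dyadic interval of `p`. -/
noncomputable def lo (p : Str) : ℝ := (val p : ℝ) / 2 ^ p.length
noncomputable def hi (p : Str) : ℝ := ((val p : ℝ) + 1) / 2 ^ p.length

theorem lo_lt_hi (p : Str) : lo p < hi p := by
  unfold lo hi
  gcongr
  linarith

theorem lo_le_of_prefix {p q : Str} (h : p <+: q) : lo p ≤ lo q := by
  obtain ⟨r, rfl⟩ := h
  unfold lo
  rw [val_append, List.length_append, pow_add, div_le_div_iff₀ (by positivity) (by positivity)]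
  push_cast
  have : (0:ℝ) ≤ val r * 2 ^ p.length := by positivity
  linarith

theorem hi_le_of_prefix {p q : Str} (h : p <+: q) : hi q ≤ hi p := by
  obtain ⟨r, rfl⟩ := h
  unfold hi
  rw [val_append, List.length_append, pow_add, div_le_div_iff₀ (by positivity) (by positivity)]
  push_cast
  have h1 : (val r : ℝ) + 1 ≤ 2 ^ r.length := by exact_mod_cast val_lt r
  have : ((val r : ℝ) + 1) * 2 ^ p.length ≤ 2 ^ r.length * 2 ^ p.length := by gcongr
  linarith

/-- One step of the accumulator. -/
def stStep (x : ℕ × ℕ) (o : Option (Str × ℕ)) : ℕ × ℕ :=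
  Option.casesOn o x (fun r => (x.1 * 2 ^ r.2 + 2 ^ x.2, x.2 + r.2))

/-- Accumulated measure `a / 2^e` of the first `i` requests, as the pair `(a, e)`. -/
def st (R : ℕ → Option (Str × ℕ)) (i : ℕ) : ℕ × ℕ :=
  Nat.rec (0, 0) (fun j x => stStep x (R j)) i

noncomputable def wt (o : Option (Str × ℕ)) : ℝ := Option.casesOn o 0 (fun r => (2⁻¹ : ℝ) ^ r.2)

theorem wt_nonneg (o : Option (Str × ℕ)) : 0 ≤ wt o := by
  cases o with
  | none => exact le_rfl
  | some r => show (0:ℝ) ≤ 2⁻¹ ^ r.2; positivity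

noncomputable def Sm (R : ℕ → Option (Str × ℕ)) (i : ℕ) : ℝ := ((st R i).1 : ℝ) / 2 ^ (st R i).2

theorem Sm_succ (R : ℕ → Option (Str × ℕ)) (i : ℕ) : Sm R (i+1) = Sm R i + wt (R i) := by
  have : st R (i+1) = stStep (st R i) (R i) := rfl
  unfold Sm
  rw [this]
  cases R i with
  | none => simp [stStep, wt]
  | some r =>
    simp only [stStep, wt]
    push_cast
    rw [pow_add, inv_pow]
    field_simp

theorem Sm_eq_sum (R : ℕ → Option (Str × ℕ)) (i : ℕ) :
    Sm R i = ∑ j ∈ Finset.range i, wt (R j) := by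
  induction i with
  | zero => simp [Sm, st]
  | succ i ih => rw [Sm_succ, ih, Finset.sum_range_succ]

theorem Sm_mono (R : ℕ → Option (Str × ℕ)) : Monotone (Sm R) :=
  monotone_nat_of_le_succ fun i => by rw [Sm_succ]; linarith [wt_nonneg (R i)]

def slot (x : ℕ × ℕ) (k : ℕ) : ℕ := (x.1 * 2 ^ (k + 1) + 2 ^ x.2 - 1) / 2 ^ x.2

theorem slot_bounds (x : ℕ × ℕ) (k : ℕ) :
    (x.1 : ℝ) / 2 ^ x.2 ≤ (slot x k : ℝ) / 2 ^ (k + 1) ∧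
    ((slot x k : ℝ) + 1) / 2 ^ (k + 1) ≤ (x.1 : ℝ) / 2 ^ x.2 + 2⁻¹ ^ k := by
  obtain ⟨a, e⟩ := x
  have hpos : 0 < 2 ^ e := by positivity
  have h1 : slot (a, e) k * 2 ^ e ≤ a * 2 ^ (k + 1) + 2 ^ e - 1 := Nat.div_mul_le_self _ _
  have h2 : a * 2 ^ (k + 1) + 2 ^ e - 1 < 2 ^ e * (slot (a, e) k + 1) := Nat.lt_mul_div_succ _ hpos
  generalize slot (a, e) k = t at *
  have h1' : t * 2 ^ e + 1 ≤ a * 2 ^ (k+1) + 2 ^ e := by omega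
  have h2' : a * 2 ^ (k+1) ≤ t * 2 ^ e := by rw [mul_add, mul_comm _ t] at h2; omega
  have h1r : (t:ℝ) * 2 ^ e + 1 ≤ a * 2 ^ (k+1) + 2 ^ e := by exact_mod_cast h1'
  have h2r : (a:ℝ) * 2 ^ (k+1) ≤ t * 2 ^ e := by exact_mod_cast h2'
  constructor
  · rw [div_le_div_iff₀ (by positivity) (by positivity)]
    exact h2r
  · have : (a:ℝ) / 2 ^ e + 2⁻¹ ^ k = (a * 2 ^ (k+1) + 2 * 2 ^ e) / (2 ^ e * 2 ^ (k+1)) := by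
      rw [inv_pow, pow_succ]; field_simp
    simp only [this]
    rw [div_le_div_iff₀ (by positivity) (by positivity)]
    have h3 : (t + 1 : ℝ) * 2 ^ e ≤ a * 2 ^ (k+1) + 2 * 2 ^ e := by linarith
    calc (t + 1 : ℝ) * (2 ^ e * 2 ^ (k+1)) = ((t + 1 : ℝ) * 2 ^ e) * 2 ^ (k+1) := by ring
      _ ≤ _ := by gcongr

/-- Test whether `p` is the program of request `i`. -/
def tst (R : ℕ → Option (Str × ℕ)) (p : Str) (i : ℕ) : Option Str :=
  (R i).bind fun r => bif (decide (p.length = r.2 + 1) && decide (val p = slot (st R i) r.2))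
    then some r.1 else none

theorem tst_iff {R : ℕ → Option (Str × ℕ)} {p : Str} {i : ℕ} {s : Str} :
    tst R p i = some s ↔
      ∃ k, R i = some (s, k) ∧ p.length = k + 1 ∧ val p = slot (st R i) k := by
  unfold tst
  cases h : R i with
  | none => simp
  | some r =>
    obtain ⟨s', k⟩ := r
    simp only [Option.bind_some, Bool.cond_eq_ite, Bool.and_eq_true, decide_eq_true_eq]
    constructor
    · intro h
      split_ifs at h with h'
      cases h
      exact ⟨k, rfl, h'⟩
    · rintro ⟨k', h1, h2⟩
      cases h1
      rw [if_pos h2]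

theorem tst_bounds {R : ℕ → Option (Str × ℕ)} {p : Str} {i : ℕ} {s : Str}
    (h : tst R p i = some s) : Sm R i ≤ lo p ∧ hi p ≤ Sm R (i + 1) := by
  obtain ⟨k, h1, h2, h3⟩ := tst_iff.1 h
  rw [Sm_succ, h1]
  unfold lo hi
  rw [h2, h3]
  exact slot_bounds _ _

theorem tst_unique {R : ℕ → Option (Str × ℕ)} {p q : Str} {i j : ℕ} {s s' : Str}
    (hp : tst R p i = some s) (hq : tst R q j = some s') (hpq : p <+: q) : i = j := by
  have h1 := tst_bounds hp
  have h2 := tst_bounds hq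
  have h3 := lo_le_of_prefix hpq
  have h4 := hi_le_of_prefix hpq
  have h5 := lo_lt_hi q
  rcases lt_trichotomy i j with h | h | h
  · have := Sm_mono R (Nat.succ_le_of_lt h)
    simp only [Nat.succ_eq_add_one] at this
    linarith
  · exact h
  · have := Sm_mono R (Nat.succ_le_of_lt h)
    simp only [Nat.succ_eq_add_one] at this
    linarith

theorem computable_st {R : ℕ → Option (Str × ℕ)} (hR : Computable R) : Computable (st R) := by
  have hstep : Primrec₂ stStep := by
    refine Primrec.option_casesOn (o := fun p : (ℕ × ℕ) × Option (Str × ℕ) => p.2)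
      (f := fun p => p.1)
      (g := fun p r => (p.1.1 * 2 ^ r.2 + 2 ^ p.1.2, p.1.2 + r.2)) Primrec.snd Primrec.fst ?_
    have hk : Primrec fun x : ((ℕ × ℕ) × Option (Str × ℕ)) × (Str × ℕ) => x.2.2 :=
      Primrec.snd.comp Primrec.snd
    have ha : Primrec fun x : ((ℕ × ℕ) × Option (Str × ℕ)) × (Str × ℕ) => x.1.1.1 :=
      Primrec.fst.comp (Primrec.fst.comp Primrec.fst)
    have he : Primrec fun x : ((ℕ × ℕ) × Option (Str × ℕ)) × (Str × ℕ) => x.1.1.2 :=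
      Primrec.snd.comp (Primrec.fst.comp Primrec.fst)
    exact Primrec.pair (Primrec.nat_add.comp (Primrec.nat_mul.comp ha (primrec_two_pow.comp hk))
      (primrec_two_pow.comp he)) (Primrec.nat_add.comp he hk)
  refine Computable.nat_rec (h := fun (_ : ℕ) (p : ℕ × (ℕ × ℕ)) => stStep p.2 (R p.1))
    Computable.id (Computable.const _) ?_
  exact hstep.to_comp.comp (Computable.snd.comp Computable.snd)
    (hR.comp (Computable.fst.comp Computable.snd))

theorem primrec_slot : Primrec₂ slot := by
  have ha : Primrec fun x : (ℕ × ℕ) × ℕ => x.1.1 := Primrec.fst.comp Primrec.fst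
  have he : Primrec fun x : (ℕ × ℕ) × ℕ => 2 ^ x.1.2 :=
    primrec_two_pow.comp (Primrec.snd.comp Primrec.fst)
  have hk : Primrec fun x : (ℕ × ℕ) × ℕ => 2 ^ (x.2 + 1) :=
    primrec_two_pow.comp (Primrec.succ.comp Primrec.snd)
  exact Primrec.nat_div.comp (Primrec.nat_sub.comp
    (Primrec.nat_add.comp (Primrec.nat_mul.comp ha hk) he) (Primrec.const 1)) he

theorem computable_tst {R : ℕ → Option (Str × ℕ)} (hR : Computable R) : Computable₂ (tst R) := by
  refine Computable.option_bind (f := fun x : Str × ℕ => R x.2)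
    (g := fun x r => bif (decide (x.1.length = r.2 + 1) && decide (val x.1 = slot (st R x.2) r.2))
    then some r.1 else none) (hR.comp Computable.snd) ?_
  have hp : Computable fun x : (Str × ℕ) × (Str × ℕ) => x.1.1 := Computable.fst.comp Computable.fst
  have hi : Computable fun x : (Str × ℕ) × (Str × ℕ) => x.1.2 := Computable.snd.comp Computable.fst
  have hk : Computable fun x : (Str × ℕ) × (Str × ℕ) => x.2.2 := Computable.snd.comp Computable.snd
  have heq : Computable₂ fun a b : ℕ => decide (a = b) := (Primrec.eq (α := ℕ)).decide.to_comp
  refine Computable.cond (Primrec.and.to_comp.comp ?_ ?_)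
    (Computable.option_some.comp (Computable.fst.comp Computable.snd)) (Computable.const none)
  · exact heq.comp (Computable.list_length.comp hp) (Computable.succ.comp hk)
  · exact heq.comp (primrec_val.to_comp.comp hp)
      (primrec_slot.to_comp.comp ((computable_st hR).comp hi) hk)

/-- Kraft–Chaitin (with one extra bit). -/
theorem kraft_chaitin (R : ℕ → Option (Str × ℕ)) (hR : Computable R)
    (hsum : ∀ N, ∑ j ∈ Finset.range N, wt (R j) ≤ 1) :
    ∃ C : Computer, ∀ i s k, R i = some (s, k) → ∃ p, s ∈ C.f p ∧ p.length = k + 1 := by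
  refine ⟨⟨fun p => Nat.rfindOpt (tst R p), Partrec.rfindOpt (computable_tst hR), ?_⟩, ?_⟩
  · intro p q hp hq hpq
    obtain ⟨i, s, hi⟩ := Nat.rfindOpt_dom.1 hp
    obtain ⟨j, s', hj⟩ := Nat.rfindOpt_dom.1 hq
    have hi : tst R p i = some s := hi
    have hj : tst R q j = some s' := hj
    have hij := tst_unique hi hj hpq
    subst hij
    obtain ⟨k, h1, h2, -⟩ := tst_iff.1 hi
    obtain ⟨k', h1', h2', -⟩ := tst_iff.1 hj
    rw [h1] at h1'
    cases h1'
    exact hpq.eq_of_length (by rw [h2, h2'])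
  · intro i s k hi
    have hb := slot_bounds (st R i) k
    have h1 : Sm R (i+1) ≤ 1 := by rw [Sm_eq_sum]; exact hsum _
    have hw : wt (R i) = 2⁻¹ ^ k := by rw [hi]; rfl
    rw [Sm_succ, hw] at h1
    have hlt : slot (st R i) k < 2 ^ (k+1) := by
      have := hb.2.trans h1
      rw [div_le_one (by positivity)] at this
      have : slot (st R i) k + 1 ≤ 2 ^ (k+1) := by exact_mod_cast this
      omega
    obtain ⟨p, hp, hv⟩ := val_surj _ _ hlt
    refine ⟨p, ?_, hp⟩
    have ht : tst R p i = some s := tst_iff.2 ⟨k, hi, hp, hv⟩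
    have hdom : (Nat.rfindOpt (tst R p)).Dom := Nat.rfindOpt_dom.2 ⟨i, s, ht⟩
    obtain ⟨s', hs'⟩ := Part.dom_iff_mem.1 hdom
    obtain ⟨j, hj⟩ := Nat.rfindOpt_spec hs'
    have hj : tst R p j = some s' := hj
    have := tst_unique hj ht (List.prefix_refl p)
    subst this
    rw [ht] at hj
    cases hj
    exact hs'

theorem sum_Ico_half (k0 N : ℕ) (h : k0 ≤ N) :
    ∑ k ∈ Finset.Ico k0 N, (2⁻¹ : ℝ) ^ k + 2 * 2⁻¹ ^ N = 2 * 2⁻¹ ^ k0 := by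
  induction N, h using Nat.le_induction with
  | base => simp
  | succ N h ih =>
    rw [Finset.sum_Ico_succ_top h, ← ih, pow_succ]
    ring

theorem sum_half_le (B : Finset ℕ) (M : ℝ) (hM : 0 ≤ M)
    (hB : ∀ k ∈ B, 2 * (2⁻¹ : ℝ) ^ k ≤ M) : ∑ k ∈ B, (2⁻¹ : ℝ) ^ k ≤ M := by
  rcases B.eq_empty_or_nonempty with rfl | hne
  · simpa using hM
  · have h0 := hB _ (B.min'_mem hne)
    have hsub : B ⊆ Finset.Ico (B.min' hne) (B.max' hne + 1) := by
      intro k hk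
      rw [Finset.mem_Ico]
      exact ⟨B.min'_le k hk, Nat.lt_succ_of_le (B.le_max' k hk)⟩
    have h1 := sum_Ico_half (B.min' hne) (B.max' hne + 1)
      ((B.min'_le _ (B.max'_mem hne)).trans (Nat.le_succ _))
    have h2 : ∑ k ∈ B, (2⁻¹ : ℝ) ^ k ≤ ∑ k ∈ Finset.Ico (B.min' hne) (B.max' hne + 1), (2⁻¹ : ℝ) ^ k :=
      Finset.sum_le_sum_of_subset_of_nonneg hsub (fun _ _ _ => by positivity)
    have h3 : (0:ℝ) ≤ 2 * 2⁻¹ ^ (B.max' hne + 1) := by positivity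
    linarith

/-- Boolean test for `2^{-k} < f n s`. -/
def gtb (f : ℕ → Str → ℚ) (n : ℕ) (s : Str) (k : ℕ) : Bool :=
  decide ((E0 (f n s)).unpair.2 < ((E0 (f n s)).unpair.1 / 2) * 2 ^ k)

theorem gtb_iff {f : ℕ → Str → ℚ} {n : ℕ} {s : Str} {k : ℕ} (h : 0 ≤ f n s) :
    gtb f n s k = true ↔ (2⁻¹ : ℝ) ^ k < (f n s : ℝ) := by
  obtain ⟨h1, h2⟩ := rat_eq_of_nonneg _ h
  rw [h1, gtb, decide_eq_true_eq, inv_pow, inv_eq_one_div,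
    div_lt_div_iff₀ (by positivity) (by exact_mod_cast h2), one_mul]
  exact_mod_cast Iff.rfl

theorem computable_gtb {f : ℕ → Str → ℚ} (hf : Computable₂ f) :
    Computable fun x : ℕ × Str × ℕ => gtb f x.1 x.2.1 x.2.2 := by
  have hE : Computable fun x : ℕ × Str × ℕ => (E0 (f x.1 x.2.1)).unpair :=
    Computable.unpair.comp (computable_E0.comp
      (hf.comp Computable.fst (Computable.fst.comp Computable.snd)))
  have hk : Computable fun x : ℕ × Str × ℕ => 2 ^ x.2.2 :=
    primrec_two_pow.to_comp.comp (Computable.snd.comp Computable.snd)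
  have hlt : Computable₂ fun a b : ℕ => decide (a < b) := Primrec.nat_lt.decide.to_comp
  have hd : Computable fun x : ℕ × Str × ℕ => (E0 (f x.1 x.2.1)).unpair.1 / 2 :=
    Primrec.nat_div.to_comp.comp (Computable.fst.comp hE) (Computable.const 2)
  have hmul : Computable fun x : ℕ × Str × ℕ => (E0 (f x.1 x.2.1)).unpair.1 / 2 * 2 ^ x.2.2 :=
    Primrec.nat_mul.to_comp.comp hd hk
  have h2 : Computable fun x : ℕ × Str × ℕ => (E0 (f x.1 x.2.1)).unpair.2 :=
    Computable.snd.comp hE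
  exact hlt.comp h2 hmul

def seen (f : ℕ → Str → ℕ → Bool) (n : ℕ) (s : Str) (k : ℕ) : Bool :=
  Nat.rec false (fun n' b => b || f n' s k) n

theorem seen_iff {f : ℕ → Str → ℕ → Bool} {n : ℕ} {s : Str} {k : ℕ} :
    seen f n s k = true ↔ ∃ n' < n, f n' s k = true := by
  induction n with
  | zero => simp [seen]
  | succ n ih =>
    have : seen f (n+1) s k = (seen f n s k || f n s k) := rfl
    rw [this, Bool.or_eq_true, ih]
    constructor
    · rintro (⟨n', h, h'⟩ | h)
      · exact ⟨n', by omega, h'⟩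
      · exact ⟨n, by omega, h⟩
    · rintro ⟨n', h, h'⟩
      rcases Nat.lt_succ_iff_lt_or_eq.1 h with h | rfl
      · exact Or.inl ⟨n', h, h'⟩
      · exact Or.inr h'

def req (f : ℕ → Str → ℕ → Bool) (i : ℕ) : Option (Str × ℕ) :=
  (Encodable.decode₂ (ℕ × Str × ℕ) i).bind fun x =>
    bif (f x.1 x.2.1 x.2.2 && !(seen f x.1 x.2.1 x.2.2)) then some (x.2.1, x.2.2 + 1) else none

theorem req_iff {f : ℕ → Str → ℕ → Bool} {i : ℕ} {s : Str} {l : ℕ} :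
    req f i = some (s, l) ↔ ∃ n k, Encodable.encode (n, s, k) = i ∧ l = k + 1 ∧
      f n s k = true ∧ seen f n s k = false := by
  unfold req
  rw [Option.bind_eq_some_iff]
  constructor
  · rintro ⟨⟨n, s', k⟩, h1, h2⟩
    have h1 := Encodable.mem_decode₂.1 h1
    simp only [Bool.cond_eq_ite, Bool.and_eq_true, Bool.not_eq_true'] at h2
    split_ifs at h2 with h3
    cases h2
    exact ⟨n, k, h1, rfl, h3⟩
  · rintro ⟨n, k, h1, h2, h3⟩
    refine ⟨(n, s, k), Encodable.mem_decode₂.2 h1, ?_⟩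
    simp [h2, h3]

theorem computable_req {f : ℕ → Str → ℕ → Bool}
    (hgt : Computable fun x : ℕ × Str × ℕ => f x.1 x.2.1 x.2.2) : Computable (req f) := by
  have hseen : Computable fun x : ℕ × Str × ℕ => seen f x.1 x.2.1 x.2.2 := by
    have hpr : Computable fun z : (ℕ × Str × ℕ) × (ℕ × Bool) => (z.2.1, z.1.2) :=
      Computable.pair (Computable.fst.comp Computable.snd) (Computable.snd.comp Computable.fst)
    have hgt' : Computable fun z : (ℕ × Str × ℕ) × (ℕ × Bool) => f z.2.1 z.1.2.1 z.1.2.2 := by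
      have := hgt.comp hpr
      exact this
    have hb : Computable fun z : (ℕ × Str × ℕ) × (ℕ × Bool) => z.2.2 :=
      Computable.snd.comp Computable.snd
    have hor : Computable₂ fun (x : ℕ × Str × ℕ) (y : ℕ × Bool) => y.2 || f y.1 x.2.1 x.2.2 :=
      Primrec.or.to_comp.comp hb hgt'
    have := Computable.nat_rec (Computable.fst (α := ℕ) (β := Str × ℕ))
      (Computable.const false) hor
    exact this
  refine Computable.option_bind (f := fun i : ℕ => Encodable.decode₂ (ℕ × Str × ℕ) i)
    (g := fun _ x => bif (f x.1 x.2.1 x.2.2 && !(seen f x.1 x.2.1 x.2.2))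
      then some (x.2.1, x.2.2 + 1) else none) Primrec.decode₂.to_comp ?_
  have hg2 := hgt.comp (Computable.snd (α := ℕ) (β := ℕ × Str × ℕ))
  have hs2 := hseen.comp (Computable.snd (α := ℕ) (β := ℕ × Str × ℕ))
  have hc := Primrec.and.to_comp.comp hg2 (Primrec.not.to_comp.comp hs2)
  have h1 : Computable fun x : ℕ × (ℕ × Str × ℕ) => x.2.2 := Computable.snd.comp Computable.snd
  have h2 : Computable fun x : ℕ × (ℕ × Str × ℕ) => some (x.2.2.1, x.2.2.2 + 1) :=
    Computable.option_some.comp (Computable.pair (Computable.fst.comp h1)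
      (Computable.succ.comp (Computable.snd.comp h1)))
  have := Computable.cond hc h2 (Computable.const none)
  exact this

theorem req_inj {f : ℕ → Str → ℕ → Bool} {i j : ℕ} {r : Str × ℕ}
    (hi : req f i = some r) (hj : req f j = some r) : i = j := by
  obtain ⟨s, l⟩ := r
  obtain ⟨n, k, h1, h2, h3, h4⟩ := req_iff.1 hi
  obtain ⟨n', k', h1', h2', h3', h4'⟩ := req_iff.1 hj
  have hk : k = k' := by omega
  subst hk
  have hn : n = n' := by
    rw [Bool.eq_false_iff, ne_eq, seen_iff] at h4 h4'
    rcases lt_trichotomy n n' with h | h | h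
    · exact absurd ⟨n, h, h3⟩ h4'
    · exact h
    · exact absurd ⟨n', h, h3'⟩ h4
  rw [← h1, ← h1', hn]

theorem req_sum {f : ℕ → Str → ℕ → Bool} {m : Str → ℝ} (hm : SemiMeasure m)
    (hf : ∀ n s k, f n s k = true → (2⁻¹ : ℝ) ^ k < m s) (N : ℕ) :
    ∑ j ∈ Finset.range N, wt (req f j) ≤ 1 := by
  classical
  set T := (Finset.range N).filter (fun i => req f i ≠ none) with hT
  set g : ℕ → Str × ℕ := fun i => (req f i).getD ([], 0) with hg
  have hgT : ∀ i ∈ T, req f i = some (g i) := by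
    intro i hi
    have := (Finset.mem_filter.1 hi).2
    obtain ⟨r, hr⟩ := Option.ne_none_iff_exists'.1 this
    simp [hg, hr]
  have h1 : ∑ j ∈ Finset.range N, wt (req f j) = ∑ j ∈ T, (2⁻¹ : ℝ) ^ (g j).2 := by
    rw [hT, Finset.sum_filter]
    refine Finset.sum_congr rfl fun i _ => ?_
    cases h : req f i with
    | none => simp [wt]
    | some r => simp [wt, hg, h]
  have hinj : Set.InjOn g T := by
    intro i hi j hj hij
    have h1 := hgT i hi
    have h2 := hgT j hj
    rw [hij] at h1
    exact req_inj h1 h2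
  have h2 : ∑ j ∈ T, (2⁻¹ : ℝ) ^ (g j).2 = ∑ r ∈ T.image g, (2⁻¹ : ℝ) ^ r.2 :=
    (Finset.sum_image (f := fun r : Str × ℕ => (2⁻¹ : ℝ) ^ r.2) hinj).symm
  rw [h1, h2]
  set A := T.image g with hA
  have hAm : ∀ r ∈ A, 2 * (2⁻¹ : ℝ) ^ r.2 ≤ m r.1 := by
    intro r hr
    obtain ⟨i, hi, rfl⟩ := Finset.mem_image.1 hr
    have := hgT i hi
    rcases hgi : g i with ⟨s, l⟩
    rw [hgi] at this
    obtain ⟨n, k, -, h2, h3, -⟩ := req_iff.1 this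
    have := hf n s k h3
    simp only [h2]
    rw [pow_succ]
    linarith
  rw [← Finset.sum_fiberwise_of_maps_to (t := A.image Prod.fst) (g := Prod.fst)
    (fun r hr => Finset.mem_image_of_mem _ hr)]
  refine le_trans (Finset.sum_le_sum fun s _ => ?_) (hm.2 (A.image Prod.fst))
  have h3 : ∑ r ∈ A with r.1 = s, (2⁻¹ : ℝ) ^ r.2 =
      ∑ k ∈ (A.filter fun r => r.1 = s).image Prod.snd, (2⁻¹ : ℝ) ^ k := by
    refine (Finset.sum_image (f := fun k : ℕ => (2⁻¹ : ℝ) ^ k) ?_).symm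
    intro a ha b hb hab
    simp only [Finset.coe_filter, Set.mem_ofPred_eq] at ha hb
    exact Prod.ext (ha.2.trans hb.2.symm) hab
  rw [h3]
  refine sum_half_le _ _ (hm.1 s).1 fun k hk => ?_
  obtain ⟨r, hr, rfl⟩ := Finset.mem_image.1 hk
  obtain ⟨hr1, hr2⟩ := Finset.mem_filter.1 hr
  rw [← hr2]
  exact hAm r hr1

theorem Kc_le {U : OptimalComputer} {s p : Str} (h : s ∈ U.f p) : Kc U s ≤ p.length :=
  Nat.sInf_le ⟨p, rfl, h⟩

theorem upper (U : OptimalComputer) (m : Str → ℝ) (hm : LCSemiMeasure m) (hpos : ∀ s, 0 < m s) :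
    ∃ c : ℕ, ∀ s, ∃ p, s ∈ U.f p ∧ (p.length : ℝ) + Real.logb 2 (m s) ≤ c := by
  obtain ⟨hsm, f, hfc, hf⟩ := hm
  obtain ⟨C, hC⟩ := kraft_chaitin (req (gtb f)) (computable_req (computable_gtb hfc))
    (req_sum hsm fun n s k h => ((gtb_iff ((hf s).1 n).1).1 h).trans_le ((hf s).1 n).2)
  obtain ⟨sim, hsim⟩ := U.optimal C
  refine ⟨sim + 3, fun s => ?_⟩
  have hex : ∃ k : ℕ, (2⁻¹ : ℝ) ^ k < m s := exists_pow_lt_of_lt_one (hpos s) (by norm_num)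
  classical
  obtain ⟨k, hk, hmin⟩ : ∃ k : ℕ, (2⁻¹ : ℝ) ^ (k+1) < m s ∧ m s ≤ 2⁻¹ ^ k := by
    rcases h : Nat.find hex with _ | k
    · have := Nat.find_spec hex
      rw [h] at this
      have h1 := (hsm.1 s).2
      simp at this
      linarith
    · refine ⟨k, h ▸ Nat.find_spec hex, ?_⟩
      exact not_lt.1 (Nat.find_min hex (m := k) (by omega))
  have hn : ∃ n, gtb f n s (k+1) = true := by
    obtain ⟨n, hn⟩ := ((hf s).2.eventually (lt_mem_nhds hk)).exists
    exact ⟨n, (gtb_iff ((hf s).1 n).1).2 hn⟩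
  have hreq : req (gtb f) (Encodable.encode (Nat.find hn, s, k+1)) = some (s, k+2) := by
    refine req_iff.2 ⟨_, _, rfl, rfl, Nat.find_spec hn, ?_⟩
    rw [Bool.eq_false_iff, ne_eq, seen_iff]
    rintro ⟨n', h1, h2⟩
    exact Nat.find_min hn h1 h2
  obtain ⟨p, hp, hl⟩ := hC _ _ _ hreq
  obtain ⟨p', hp', hl'⟩ := hsim p s hp
  refine ⟨p', hp', ?_⟩
  have h1 : Real.logb 2 (m s) ≤ -k := by
    rw [Real.logb_le_iff_le_rpow (by norm_num) (hpos s), Real.rpow_neg (by norm_num), Real.rpow_natCast,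
      ← inv_pow]
    exact hmin
  have h2 : (p'.length : ℝ) ≤ k + 3 + sim := by
    rw [hl] at hl'
    exact_mod_cast hl'
  push_cast
  linarith

/-- Candidate length (plus one) found at step `i`, or `0`. -/
def cand (c : Nat.Partrec.Code) (i : ℕ) (s : Str) : ℕ :=
  ((Encodable.decode (α := ℕ × Str) i).bind fun x =>
    bif decide (Nat.Partrec.Code.evaln x.1 c (Encodable.encode x.2) = some (Encodable.encode s))
    then some (x.2.length + 1) else none).getD 0

def upd (a b : ℕ) : ℕ := if b = 0 then a else if a = 0 then b else min a b

def best (e : ℕ → Str → ℕ) (n : ℕ) (s : Str) : ℕ := Nat.rec 0 (fun i a => upd a (e i s)) n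

theorem Q_zero : Q 0 = 0 := rfl
theorem Q_succ (l : ℕ) : Q (l+1) = 2⁻¹ ^ l := rfl

theorem Q_nonneg (l : ℕ) : 0 ≤ Q l := by
  cases l with
  | zero => exact le_rfl
  | succ l => rw [Q_succ]; positivity

theorem Q_upd (a b : ℕ) : Q (upd a b) = max (Q a) (Q b) := by
  unfold upd
  split_ifs with h1 h2
  · subst h1; rw [Q_zero, max_eq_left (Q_nonneg a)]
  · subst h2; rw [Q_zero, max_eq_right (Q_nonneg b)]
  · obtain ⟨a, rfl⟩ := Nat.exists_eq_succ_of_ne_zero h2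
    obtain ⟨b, rfl⟩ := Nat.exists_eq_succ_of_ne_zero h1
    simp only [Nat.succ_eq_add_one, Nat.add_min_add_right, Q_succ]
    rcases le_total a b with h | h
    · rw [min_eq_left h, max_eq_left (pow_le_pow_of_le_one (by norm_num) (by norm_num) h)]
    · rw [min_eq_right h, max_eq_right (pow_le_pow_of_le_one (by norm_num) (by norm_num) h)]

theorem Q_best_succ (e : ℕ → Str → ℕ) (n : ℕ) (s : Str) :
    Q (best e (n+1) s) = max (Q (best e n s)) (Q (e n s)) := Q_upd _ _

theorem computable_best {e : ℕ → Str → ℕ} (he : Computable₂ e) : Computable₂ (best e) := by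
  have hupd : Primrec₂ upd :=
    Primrec.ite (Primrec.eq.comp Primrec.snd (Primrec.const 0)) Primrec.fst
      (Primrec.ite (Primrec.eq.comp Primrec.fst (Primrec.const 0)) Primrec.snd
        (Primrec.nat_min.comp Primrec.fst Primrec.snd))
  have h1 : Computable fun z : (ℕ × Str) × (ℕ × ℕ) => z.2.2 := Computable.snd.comp Computable.snd
  have h2 : Computable fun z : (ℕ × Str) × (ℕ × ℕ) => z.2.1 := Computable.fst.comp Computable.snd
  have h3 : Computable fun z : (ℕ × Str) × (ℕ × ℕ) => z.1.2 := Computable.snd.comp Computable.fst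
  have h4 := he.comp h2 h3
  have h5 := hupd.to_comp.comp h1 h4
  have h6 : Computable₂ fun (x : ℕ × Str) (y : ℕ × ℕ) => upd y.2 (e y.1 x.2) := h5
  have := Computable.nat_rec (Computable.fst (α := ℕ) (β := Str)) (Computable.const 0) h6
  exact this

theorem computable_cand (c : Nat.Partrec.Code) : Computable₂ (cand c) := by
  have hd : Computable fun z : ℕ × Str => Encodable.decode (α := ℕ × Str) z.1 :=
    Computable.decode.comp Computable.fst
  have h1 : Primrec fun z : (ℕ × Str) × (ℕ × Str) => ((z.2.1, c), Encodable.encode z.2.2) :=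
    Primrec.pair (Primrec.pair (Primrec.fst.comp Primrec.snd) (Primrec.const c))
      (Primrec.encode.comp (Primrec.snd.comp Primrec.snd))
  have h2 := Nat.Partrec.Code.primrec_evaln.comp h1
  have h3 : Primrec fun z : (ℕ × Str) × (ℕ × Str) => some (Encodable.encode z.1.2) :=
    Primrec.option_some.comp (Primrec.encode.comp (Primrec.snd.comp Primrec.fst))
  have h4 := (Primrec.eq.comp h2 h3).decide
  have h5 : Primrec fun z : (ℕ × Str) × (ℕ × Str) => some (z.2.2.length + 1) :=
    Primrec.option_some.comp (Primrec.succ.comp (Primrec.list_length.comp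
      (Primrec.snd.comp Primrec.snd)))
  have h6 := (Primrec.cond h4 h5 (Primrec.const none)).to_comp
  have h7 := Computable.option_bind hd h6.to₂
  have h8 := Computable.option_getD h7 (Computable.const 0)
  exact h8.of_eq fun _ => rfl

theorem cand_spec {c : Nat.Partrec.Code} {i : ℕ} {s : Str} {l : ℕ} (h : cand c i s = l + 1) :
    ∃ p : Str, p.length = l ∧ Encodable.encode s ∈ c.eval (Encodable.encode p) := by
  unfold cand at h
  cases hd : Encodable.decode (α := ℕ × Str) i with
  | none => simp [hd] at h
  | some x =>
    simp only [hd, Option.bind_some, Bool.cond_eq_ite, decide_eq_true_eq] at h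
    split_ifs at h with h1
    · simp only [Option.getD_some] at h
      exact ⟨x.2, by omega, Nat.Partrec.Code.evaln_sound h1⟩
    · simp at h

theorem exists_cand {c : Nat.Partrec.Code} {s p : Str}
    (h : Encodable.encode s ∈ c.eval (Encodable.encode p)) : ∃ i, cand c i s = p.length + 1 := by
  obtain ⟨t, ht⟩ := Nat.Partrec.Code.evaln_complete.1 h
  have ht : Nat.Partrec.Code.evaln t c (Encodable.encode p) = some (Encodable.encode s) := ht
  refine ⟨Encodable.encode (t, p), ?_⟩
  simp [cand, Encodable.encodek, ht]

theorem exists_min_prog {U : OptimalComputer} {s : Str} (h : ∃ p, s ∈ U.f p) :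
    ∃ p, s ∈ U.f p ∧ p.length = Kc U s := by
  obtain ⟨p, hp⟩ := h
  have : Kc U s ∈ {n | ∃ p : Str, p.length = n ∧ s ∈ U.f p} := Nat.sInf_mem ⟨_, p, rfl, hp⟩
  obtain ⟨q, h1, h2⟩ := this
  exact ⟨q, h2, h1⟩

theorem lowerComputable_K (U : OptimalComputer) (hex : ∀ s, ∃ p, s ∈ U.f p) :
    LowerComputable (fun s => (2⁻¹ : ℝ) ^ Kc U s) := by
  obtain ⟨c, hc⟩ := Nat.Partrec.Code.exists_code.1 U.partrec
  have hc' : ∀ s p : Str, Encodable.encode s ∈ c.eval (Encodable.encode p) ↔ s ∈ U.f p := by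
    intro s p
    rw [hc]
    simp [Encodable.encodek]
  have hcomp : Computable₂ fun n s => Q (best (cand c) n s) :=
    computable_Q.comp (computable_best (computable_cand c))
  refine ⟨fun n s => Q (best (cand c) n s), hcomp, fun s => ?_⟩
  have hle : ∀ i, (Q (cand c i s) : ℝ) ≤ 2⁻¹ ^ Kc U s := by
    intro i
    rcases h : cand c i s with _ | l
    · rw [Q_zero]; push_cast; positivity
    · obtain ⟨p, hp, hp'⟩ := cand_spec h
      have := Kc_le ((hc' s p).1 hp')
      rw [Q_succ]; push_cast
      exact pow_le_pow_of_le_one (by norm_num) (by norm_num) (hp ▸ this)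
  have hle2 : ∀ n, (Q (best (cand c) n s) : ℝ) ≤ 2⁻¹ ^ Kc U s := by
    intro n
    induction n with
    | zero => show ((Q 0 : ℚ) : ℝ) ≤ _; rw [Q_zero]; push_cast; positivity
    | succ n ih => rw [Q_best_succ, Rat.cast_max]; exact max_le ih (hle n)
  refine ⟨fun n => ⟨Q_nonneg _, hle2 n⟩, ?_⟩
  obtain ⟨p, hp, hpl⟩ := exists_min_prog (hex s)
  obtain ⟨i, hi⟩ := exists_cand ((hc' s p).2 hp)
  have hmono : Monotone fun n => Q (best (cand c) n s) :=
    monotone_nat_of_le_succ fun n => by rw [Q_best_succ]; exact le_max_left _ _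
  refine tendsto_const_nhds.congr' ?_
  filter_upwards [eventually_ge_atTop (i+1)] with n hn
  refine le_antisymm ?_ (hle2 n)
  have h1 : Q (cand c i s) ≤ Q (best (cand c) n s) := by
    refine le_trans ?_ (hmono hn)
    show _ ≤ Q (best (cand c) (i+1) s)
    rw [Q_best_succ]
    exact le_max_right _ _
  rw [hi, Q_succ, hpl] at h1
  have h2 : (((2⁻¹:ℚ) ^ Kc U s : ℚ) : ℝ) ≤ ((Q (best (cand c) n s) : ℚ) : ℝ) := Rat.cast_le.2 h1
  push_cast at h2
  exact h2

theorem uniquelyDecodable_of_prefixFree (S : Set Str) (h0 : [] ∉ S)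
    (h : ∀ p ∈ S, ∀ q ∈ S, p <+: q → p = q) : InformationTheory.UniquelyDecodable S := by
  intro L₁
  induction L₁ with
  | nil =>
    intro L₂ _ h2 he
    cases L₂ with
    | nil => rfl
    | cons q L =>
      simp only [List.flatten_nil, List.flatten_cons] at he
      have := (List.append_eq_nil_iff.1 he.symm).1
      exact absurd (h2 q (by simp)) (this ▸ h0)
  | cons p L ih =>
    intro L₂ h1 h2 he
    cases L₂ with
    | nil =>
      simp only [List.flatten_nil, List.flatten_cons] at he
      have := (List.append_eq_nil_iff.1 he).1
      exact absurd (h1 p (by simp)) (this ▸ h0)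
    | cons q L' =>
      simp only [List.flatten_cons] at he
      have hp := h1 p (by simp)
      have hq := h2 q (by simp)
      have hpq : p = q := by
        rcases List.prefix_or_prefix_of_prefix (l₃ := p ++ L.flatten) (List.prefix_append p _)
          (he ▸ List.prefix_append q _) with h' | h'
        · exact h p hp q hq h'
        · exact (h q hq p hp h').symm
      subst hpq
      rw [ih L' (fun w hw => h1 w (by simp [hw])) (fun w hw => h2 w (by simp [hw]))
        (List.append_cancel_left he)]

theorem kraft (S : Finset Str) (h : ∀ p ∈ S, ∀ q ∈ S, p <+: q → p = q) :
    ∑ p ∈ S, (2⁻¹ : ℝ) ^ p.length ≤ 1 := by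
  by_cases h0 : [] ∈ S
  · have : S ⊆ {[]} := by
      intro q hq
      rw [Finset.mem_singleton]
      exact (h [] h0 q hq List.nil_prefix).symm
    refine (Finset.sum_le_sum_of_subset_of_nonneg this fun _ _ _ => by positivity).trans ?_
    simp
  · have := InformationTheory.kraft_mcmillan_inequality
      (uniquelyDecodable_of_prefixFree (S : Set Str) (by simpa using h0) (by simpa using h))
    simpa using this

theorem semiMeasure_K (U : OptimalComputer) (hex : ∀ s, ∃ p, s ∈ U.f p) :
    SemiMeasure (fun s => (2⁻¹ : ℝ) ^ Kc U s) := by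
  refine ⟨fun s => ⟨by positivity, pow_le_one₀ (by norm_num) (by norm_num)⟩, fun F => ?_⟩
  choose g hg hl using fun s => exists_min_prog (hex s)
  have hinj : Function.Injective g := by
    intro s t hst
    have h1 := hg s
    have h2 := hg t
    rw [hst] at h1
    exact Part.mem_unique h1 h2
  have h1 : ∑ s ∈ F, (2⁻¹ : ℝ) ^ Kc U s = ∑ p ∈ F.map ⟨g, hinj⟩, (2⁻¹ : ℝ) ^ p.length := by
    rw [Finset.sum_map]
    simp [hl]
  rw [h1]
  refine kraft _ fun p hp q hq hpq => ?_
  obtain ⟨s, -, rfl⟩ := Finset.mem_map.1 hp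
  obtain ⟨t, -, rfl⟩ := Finset.mem_map.1 hq
  exact U.prefixFree _ _ (Part.dom_iff_mem.2 ⟨s, hg s⟩) (Part.dom_iff_mem.2 ⟨t, hg t⟩) hpq

theorem universal_pos {m : Str → ℝ} (hm : UniversalProb m) (s₀ : Str) : 0 < m s₀ := by
  have hr : LCSemiMeasure (fun s => if s = s₀ then (1:ℝ) else 0) := by
    refine ⟨⟨fun s => by by_cases h : s = s₀ <;> simp [h], fun F => ?_⟩,
      fun _ s => if s = s₀ then 1 else 0, ?_, fun s => ⟨fun _ => ?_, ?_⟩⟩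
    · rw [Finset.sum_ite_eq' F s₀]
      split_ifs <;> norm_num
    · exact (Primrec.ite (Primrec.eq.comp Primrec.snd (Primrec.const s₀))
        (Primrec.const 1) (Primrec.const 0)).to_comp
    · by_cases h : s = s₀ <;> simp [h]
    · by_cases h : s = s₀ <;> simp [h]
  obtain ⟨c, hc, h⟩ := hm.2 _ hr
  have := h s₀
  simp at this
  linarith

/-- For every universal probability `m`, `K s = -log₂ (m s) + O(1)`. -/
theorem K_eq_neg_log_universal (U : OptimalComputer) (m : Str → ℝ)
    (hm : UniversalProb m) :
    ∃ c : ℕ, ∀ s : Str, |(Kc U s : ℝ) + Real.logb 2 (m s)| ≤ c := by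
  have hpos := universal_pos hm
  obtain ⟨c₁, h₁⟩ := upper U m hm.1 hpos
  have hex : ∀ s, ∃ p, s ∈ U.f p := fun s => (h₁ s).imp fun p hp => hp.1
  obtain ⟨d, hd, h₂⟩ := hm.2 _ ⟨semiMeasure_K U hex, lowerComputable_K U hex⟩
  obtain ⟨c₂, hc₂⟩ := exists_nat_ge (-Real.logb 2 d)
  refine ⟨c₁ + c₂, fun s => abs_le.2 ⟨?_, ?_⟩⟩
  · have h3 : Real.logb 2 (d * 2⁻¹ ^ Kc U s) ≤ Real.logb 2 (m s) :=
      Real.logb_le_logb_of_le (by norm_num) (by positivity) (h₂ s)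
    rw [Real.logb_mul hd.ne' (by positivity), Real.logb_pow, Real.logb_inv,
      Real.logb_self_eq_one (by norm_num)] at h3
    push_cast
    have : (0:ℝ) ≤ c₁ := by positivity
    linarith
  · obtain ⟨p, hp, hp'⟩ := h₁ s
    have h3 : (Kc U s : ℝ) ≤ p.length := by exact_mod_cast Kc_le hp
    push_cast
    have : (0:ℝ) ≤ c₂ := by positivity
    linarith

end Paper
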